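/- For every natural number n and real C > 0, the imaginary Gaussian integral of x^{2n} with covariance ±iC equals (±iC)^n · (2n−1)!!, where (2n−1)!! = (2n−1)(2n−3)···3·1. Equivalently, ∫_{Γ} exp(−z²/(±2iC)) z^{2n} dz / √(±2πiC) = (±iC)^n (2n−1)!! for Γ the deformed contour {x ± iε tanh x}. -/

import Mathlib

open MeasureTheory Real Complex

/-- The regularized contour `x ↦ x + s·i ε tanh x`, where `s = ±1`. -/
noncomputable def gaussContourS (s ε x : ℝ) : ℂ := x + s * Complex.I * ε * Real.tanh x

/-- Derivative of the contour. -/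
noncomputable def gaussContourSDeriv (s ε x : ℝ) : ℂ :=
  1 + s * Complex.I * ε * (1 - Real.tanh x ^ 2)

open Filter Topology

/-- The unnormalized integrand `exp (-z ^ 2 / (2 s i C)) * z ^ m`. -/
noncomputable def imagGaussKernel (s C : ℝ) (m : ℕ) (z : ℂ) : ℂ :=
  Complex.exp (-z ^ 2 / (s * 2 * Complex.I * C)) * z ^ m

theorem Real.mul_one_sub_tanh_le_one (x : ℝ) : x * (1 - Real.tanh x) ≤ 1 := by
  have hx : 2 * x + 1 ≤ Real.exp (2 * x) := Real.add_one_le_exp _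
  have hexp : Real.exp (2 * x) = Real.exp x * Real.exp x := by rw [← Real.exp_add]; ring_nf
  have hne : Real.exp x ≠ 0 := (Real.exp_pos x).ne'
  have hpos : 0 < Real.exp x * Real.exp x + 1 := by positivity
  have htanh : 1 - Real.tanh x = 2 / (Real.exp x * Real.exp x + 1) := by
    rw [Real.tanh_eq, Real.exp_neg]
    field_simp
    ring
  rw [htanh, ← mul_div_assoc, div_le_one hpos]
  linarith

theorem Real.abs_sub_one_le_mul_tanh (x : ℝ) : |x| - 1 ≤ x * Real.tanh x := by
  rcases abs_cases x with ⟨h, -⟩ | ⟨h, -⟩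
  · have := Real.mul_one_sub_tanh_le_one x
    linarith
  · have := Real.mul_one_sub_tanh_le_one (-x)
    rw [Real.tanh_neg] at this
    linarith

theorem Real.hasDerivAt_tanh_one_sub_sq (x : ℝ) :
    HasDerivAt Real.tanh (1 - Real.tanh x ^ 2) x := by
  have hc : Real.cosh x ≠ 0 := (Real.cosh_pos x).ne'
  have h := (Real.hasDerivAt_sinh x).div (Real.hasDerivAt_cosh x) hc
  have hfun : Real.tanh = Real.sinh / Real.cosh := by
    ext y; exact Real.tanh_eq_sinh_div_cosh y
  rw [hfun]
  refine h.congr_deriv ?_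
  simp only [Pi.div_apply]
  field_simp

theorem hasDerivAt_gaussContourS (s ε x : ℝ) :
    HasDerivAt (gaussContourS s ε) (gaussContourSDeriv s ε x) x := by
  have h := (Real.hasDerivAt_tanh_one_sub_sq x).ofReal_comp.const_mul (s * Complex.I * ε)
  have h' := (hasDerivAt_id x).ofReal_comp.add h
  refine h'.congr_deriv ?_
  simp [gaussContourSDeriv]

theorem continuous_gaussContourS (s ε : ℝ) : Continuous (gaussContourS s ε) :=
  continuous_iff_continuousAt.2 fun x => (hasDerivAt_gaussContourS s ε x).continuousAt

theorem continuous_gaussContourSDeriv (s ε : ℝ) : Continuous (gaussContourSDeriv s ε) := by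
  have h : Continuous Real.tanh :=
    continuous_iff_continuousAt.2 fun x => (Real.hasDerivAt_tanh_one_sub_sq x).continuousAt
  unfold gaussContourSDeriv
  fun_prop

theorem differentiable_imagGaussKernel (s C : ℝ) (m : ℕ) :
    Differentiable ℂ (imagGaussKernel s C m) := by
  unfold imagGaussKernel
  fun_prop

theorem norm_imagGaussKernel {s C : ℝ} (hs : s = 1 ∨ s = -1) (hC : 0 < C) (m : ℕ) (x y : ℝ) :
    ‖imagGaussKernel s C m (x + s * Complex.I * y)‖ =
      Real.exp (-(x * y) / C) * ‖(x + s * Complex.I * y : ℂ)‖ ^ m := by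
  have hC' : (C : ℂ) ≠ 0 := by exact_mod_cast hC.ne'
  have key : -(x + s * Complex.I * y : ℂ) ^ 2 / (s * 2 * Complex.I * C) =
      ((-(x * y) / C : ℝ) : ℂ) + ((s * (x ^ 2 - y ^ 2) / (2 * C) : ℝ) : ℂ) * Complex.I := by
    rcases hs with rfl | rfl <;> push_cast <;> field_simp <;> ring_nf <;>
      simp only [Complex.I_sq] <;> ring
  rw [imagGaussKernel, norm_mul, norm_pow, key, Complex.norm_exp, Complex.add_re,
    Complex.ofReal_re, Complex.re_ofReal_mul, Complex.I_re, mul_zero, add_zero]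

theorem norm_add_sign_mul_I_le {s : ℝ} (hs : s = 1 ∨ s = -1) (x y : ℝ) :
    ‖(x + s * Complex.I * y : ℂ)‖ ≤ |x| + |y| := by
  refine (norm_add_le _ _).trans_eq ?_
  rcases hs with rfl | rfl <;> simp

theorem norm_gaussContourSDeriv_le {s ε : ℝ} (hs : s = 1 ∨ s = -1) (hε : 0 < ε) (x : ℝ) :
    ‖gaussContourSDeriv s ε x‖ ≤ 1 + ε := by
  have ht : |1 - Real.tanh x ^ 2| ≤ 1 := by
    have h1 := Real.tanh_lt_one x
    have h2 := Real.neg_one_lt_tanh x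
    rw [abs_le]
    constructor <;> nlinarith
  have h : gaussContourSDeriv s ε x =
      ((1 : ℝ) : ℂ) + s * Complex.I * ((ε * (1 - Real.tanh x ^ 2) : ℝ) : ℂ) := by
    simp only [gaussContourSDeriv]; push_cast; ring
  rw [h]
  refine (norm_add_sign_mul_I_le hs _ _).trans ?_
  rw [abs_mul, abs_one, abs_of_pos hε]
  nlinarith

theorem gaussContourS_eq (s ε x : ℝ) :
    gaussContourS s ε x = x + s * Complex.I * ((ε * Real.tanh x : ℝ) : ℂ) := by
  simp only [gaussContourS]; push_cast; ring

theorem exp_neg_mul_tanh_le {ε C : ℝ} (hε : 0 < ε) (hC : 0 < C) (x : ℝ) :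
    Real.exp (-(x * (ε * Real.tanh x)) / C) ≤
      Real.exp (ε / C) * Real.exp (-(ε / C * |x|)) := by
  rw [← Real.exp_add, Real.exp_le_exp]
  have h := mul_le_mul_of_nonneg_left (Real.abs_sub_one_le_mul_tanh x) (div_pos hε hC).le
  have : -(x * (ε * Real.tanh x)) / C = -(ε / C * (x * Real.tanh x)) := by ring
  rw [this]
  linarith

theorem integrable_one_add_abs_pow_mul_exp_neg {δ : ℝ} (hδ : 0 < δ) (m : ℕ) :
    Integrable fun x : ℝ => (1 + |x|) ^ m * Real.exp (-(δ * |x|)) := by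
  have hK := integrable_inv_one_add_sq.const_mul
    ((m + 2).factorial / δ ^ (m + 2) * Real.exp δ)
  refine hK.mono' (by fun_prop) (ae_of_all _ fun x => ?_)
  have ha : 0 ≤ |x| := abs_nonneg x
  have h := Real.pow_div_factorial_le_exp (x := δ * (1 + |x|)) (by positivity) (m + 2)
  rw [Real.norm_of_nonneg (by positivity), Real.exp_neg, ← div_eq_mul_inv, ← div_eq_mul_inv,
    div_le_div_iff₀ (Real.exp_pos _) (by positivity)]
  rw [div_le_iff₀ (by positivity), mul_pow, mul_add, mul_one, Real.exp_add] at h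
  have hsq : 1 + x ^ 2 ≤ (1 + |x|) ^ 2 := by nlinarith [sq_abs x]
  calc (1 + |x|) ^ m * (1 + x ^ 2) ≤ (1 + |x|) ^ m * (1 + |x|) ^ 2 := by gcongr
    _ = (δ ^ (m + 2) * (1 + |x|) ^ (m + 2)) / δ ^ (m + 2) := by field_simp; ring
    _ ≤ (Real.exp δ * Real.exp (δ * |x|) * (m + 2).factorial) / δ ^ (m + 2) := by gcongr
    _ = _ := by ring

theorem integrable_imagGaussKernel_contour {s C ε : ℝ} (hs : s = 1 ∨ s = -1) (hC : 0 < C)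
    (hε : 0 < ε) (m : ℕ) :
    Integrable fun x : ℝ =>
      imagGaussKernel s C m (gaussContourS s ε x) * gaussContourSDeriv s ε x := by
  have hint := (integrable_one_add_abs_pow_mul_exp_neg (div_pos hε hC) m).const_mul
    (Real.exp (ε / C) * (1 + ε) ^ m * (1 + ε))
  have hcont : Continuous fun x : ℝ =>
      imagGaussKernel s C m (gaussContourS s ε x) * gaussContourSDeriv s ε x :=
    ((differentiable_imagGaussKernel s C m).continuous.comp (continuous_gaussContourS s ε)).mul
      (continuous_gaussContourSDeriv s ε)
  refine hint.mono' hcont.aestronglyMeasurable (ae_of_all _ fun x => ?_)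
  have ht : |Real.tanh x| ≤ 1 :=
    abs_le.2 ⟨(Real.neg_one_lt_tanh x).le, (Real.tanh_lt_one x).le⟩
  have hnorm : ‖(x + s * Complex.I * ((ε * Real.tanh x : ℝ) : ℂ) : ℂ)‖ ≤ (1 + ε) * (1 + |x|) := by
    refine (norm_add_sign_mul_I_le hs _ _).trans ?_
    rw [abs_mul, abs_of_pos hε]
    nlinarith [abs_nonneg x, mul_nonneg hε.le (abs_nonneg x)]
  rw [norm_mul, gaussContourS_eq, norm_imagGaussKernel hs hC]
  calc _ ≤ (Real.exp (ε / C) * Real.exp (-(ε / C * |x|))) * ((1 + ε) * (1 + |x|)) ^ m * (1 + ε) := by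
        gcongr
        · exact exp_neg_mul_tanh_le hε hC x
        · exact norm_gaussContourSDeriv_le hs hε x
    _ = _ := by rw [mul_pow]; ring

/-- Any primitive of the kernel takes asymptotically equal values on the regularized contour and
on the steepest-descent line. -/
theorem tendsto_primitive_contour_sub_diagonal {s C ε : ℝ} (hs : s = 1 ∨ s = -1) (hC : 0 < C)
    (hε : 0 < ε) (m : ℕ) {G : ℂ → ℂ} (hG : ∀ z, HasDerivAt G (imagGaussKernel s C m z) z) :
    Tendsto (fun R : ℝ => G ((1 + s * Complex.I) * R) - G (gaussContourS s ε R)) atTop (𝓝 0) := by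
  have hlim : Tendsto (fun R : ℝ => Real.exp (ε / C) * 2 ^ m *
      (R ^ (m + 1) / Real.exp (ε / C * R))) atTop (𝓝 0) := by
    simpa using ((isLittleO_pow_exp_pos_mul_atTop (m + 1) (div_pos hε hC)).tendsto_div_nhds_zero
      ).const_mul (Real.exp (ε / C) * 2 ^ m)
  refine squeeze_zero_norm' ?_ hlim
  filter_upwards [eventually_ge_atTop ε, eventually_gt_atTop 0] with R hR hR0
  have htanh : 0 ≤ Real.tanh R := by
    rw [Real.tanh_eq_sinh_div_cosh]
    exact div_nonneg (Real.sinh_nonneg_iff.2 hR0.le) (Real.cosh_pos R).le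
  have hle : ε * Real.tanh R ≤ R := by nlinarith [Real.tanh_lt_one R]
  have hder : ∀ y : ℝ, HasDerivAt (fun y : ℝ => G (R + s * Complex.I * y))
      (imagGaussKernel s C m (R + s * Complex.I * y) * (s * Complex.I)) y := by
    intro y
    have hline : HasDerivAt (fun y : ℝ => (R + s * Complex.I * y : ℂ)) (s * Complex.I) y := by
      simpa using ((hasDerivAt_id y).ofReal_comp.const_mul (s * Complex.I : ℂ)).const_add (R : ℂ)
    exact (hG _).comp y hline
  have hbound : ∀ y ∈ Set.Ico (ε * Real.tanh R) R,
      ‖imagGaussKernel s C m (R + s * Complex.I * y) * (s * Complex.I)‖ ≤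
        (Real.exp (ε / C) * Real.exp (-(ε / C * |R|))) * (2 * R) ^ m := by
    intro y hy
    have hy0 : 0 ≤ y := le_trans (by positivity) hy.1
    have hsI : ‖(s * Complex.I : ℂ)‖ = 1 := by rcases hs with rfl | rfl <;> simp
    rw [norm_mul, hsI, mul_one, norm_imagGaussKernel hs hC]
    gcongr
    · refine le_trans ?_ (exp_neg_mul_tanh_le hε hC R)
      gcongr
      exact hy.1
    · refine (norm_add_sign_mul_I_le hs _ _).trans ?_
      rw [abs_of_pos hR0, abs_of_nonneg hy0]
      linarith [hy.2]
  have hmv := norm_image_sub_le_of_norm_deriv_le_segment'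
    (fun y _ => (hder y).hasDerivWithinAt) hbound R (Set.right_mem_Icc.2 hle)
  rw [gaussContourS_eq, show (1 + s * Complex.I) * (R : ℂ) = R + s * Complex.I * R by ring]
  refine hmv.trans ?_
  rw [abs_of_pos hR0, Real.exp_neg]
  calc _ ≤ Real.exp (ε / C) * (Real.exp (ε / C * R))⁻¹ * (2 * R) ^ m * R := by
        gcongr
        linarith [mul_nonneg hε.le htanh]
    _ = _ := by rw [mul_pow]; ring

theorem integral_pow_even_mul_exp_neg_sq_div {C : ℝ} (hC : 0 < C) (n : ℕ) :
    ∫ x : ℝ, x ^ (2 * n) * Real.exp (-x ^ 2 / C) =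
      √(π * C) * (C / 2) ^ n * ((2 * n - 1).doubleFactorial : ℕ) := by
  have habs : ∀ x : ℝ, x ^ (2 * n) * Real.exp (-x ^ 2 / C) =
      (fun y : ℝ => y ^ (2 * n) * Real.exp (-y ^ 2 / C)) |x| := by
    intro x
    simp only [pow_mul, sq_abs]
  rw [integral_congr_ae (ae_of_all _ habs),
    integral_comp_abs (f := fun y : ℝ => y ^ (2 * n) * Real.exp (-y ^ 2 / C))]
  have h := _root_.integral_rpow_mul_exp_neg_mul_rpow (p := 2) (q := ((2 * n : ℕ) : ℝ)) (b := C⁻¹)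
    (by norm_num) (lt_of_lt_of_le (by norm_num) (Nat.cast_nonneg _)) (by positivity)
  simp only [Real.rpow_natCast, Real.rpow_ofNat] at h
  have hexp : (((2 * n : ℕ) : ℝ) + 1) / 2 = n + 1 / 2 := by push_cast; ring
  rw [neg_div, hexp, Real.Gamma_nat_add_half, Real.rpow_neg (by positivity),
    Real.inv_rpow hC.le, inv_inv, Real.rpow_add hC, Real.rpow_natCast, ← Real.sqrt_eq_rpow] at h
  have hcongr : ∀ y : ℝ, y ^ (2 * n) * Real.exp (-y ^ 2 / C) =
      y ^ (2 * n) * Real.exp (-C⁻¹ * y ^ 2) := by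
    intro y; congr 2; ring
  simp_rw [hcongr]
  rw [h, Real.sqrt_mul pi_pos.le, div_pow]
  ring

theorem imagGaussKernel_diagonal {s C : ℝ} (hs : s = 1 ∨ s = -1) (hC : 0 < C) (n : ℕ) (x : ℝ) :
    imagGaussKernel s C (2 * n) ((1 + s * Complex.I) * x) =
      (2 * s * Complex.I) ^ n * ((x ^ (2 * n) * Real.exp (-x ^ 2 / C) : ℝ) : ℂ) := by
  have hC' : (C : ℂ) ≠ 0 := by exact_mod_cast hC.ne'
  have hsq : ((1 + s * Complex.I) * x) ^ 2 = 2 * s * Complex.I * (x : ℂ) ^ 2 := by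
    rcases hs with rfl | rfl <;> push_cast <;> ring_nf <;> simp only [Complex.I_sq] <;> ring
  have hs0 : (s : ℂ) ≠ 0 := by rcases hs with rfl | rfl <;> simp
  have hexp : -(2 * s * Complex.I * (x : ℂ) ^ 2) / (s * 2 * Complex.I * C) = -x ^ 2 / C := by
    field_simp
  rw [imagGaussKernel, pow_mul, hsq, hexp, mul_pow]
  push_cast
  ring

theorem sign_two_pi_I_cpow_half {s C : ℝ} (hs : s = 1 ∨ s = -1) (hC : 0 < C) :
    (s * 2 * Real.pi * Complex.I * C : ℂ) ^ ((1 : ℂ) / 2) =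
      (1 + s * Complex.I) * (√(π * C) : ℝ) := by
  have hpos : 0 < √(π * C) := Real.sqrt_pos.2 (by positivity)
  have hroot : ((√(π * C) : ℝ) : ℂ) ^ 2 = π * C := by
    rw [← Complex.ofReal_pow, Real.sq_sqrt (by positivity)]
    push_cast
    rfl
  have hsq : (s * 2 * Real.pi * Complex.I * C : ℂ) = ((1 + s * Complex.I) * (√(π * C) : ℝ)) ^ 2 := by
    rw [mul_pow, hroot]
    rcases hs with rfl | rfl <;> push_cast <;> ring_nf <;> simp only [Complex.I_sq] <;> ring
  have hre : 0 < ((1 + s * Complex.I) * (√(π * C) : ℝ) : ℂ).re := by simpa using hpos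
  have harg := Complex.abs_arg_lt_pi_div_two_iff.2 (Or.inl hre)
  rw [abs_lt] at harg
  rw [hsq]
  have := Complex.pow_cpow_nat_inv (x := ((1 + s * Complex.I) * (√(π * C) : ℝ) : ℂ)) (n := 2)
    two_ne_zero (by simpa using harg.1) (by simpa using harg.2.le)
  simpa using this

theorem integrable_pow_mul_exp_neg_sq_div {C : ℝ} (hC : 0 < C) (m : ℕ) :
    Integrable fun x : ℝ => x ^ m * Real.exp (-x ^ 2 / C) := by
  have h := integrable_rpow_mul_exp_neg_mul_sq (inv_pos.2 hC) (s := m)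
    (lt_of_lt_of_le (by norm_num) (Nat.cast_nonneg _))
  refine h.congr (ae_of_all _ fun x => ?_)
  simp only [Real.rpow_natCast]
  congr 2
  ring

theorem integral_imagGaussKernel_contour {s C ε : ℝ} (hs : s = 1 ∨ s = -1) (hC : 0 < C)
    (hε : 0 < ε) (n : ℕ) :
    ∫ x : ℝ, imagGaussKernel s C (2 * n) (gaussContourS s ε x) * gaussContourSDeriv s ε x =
      ∫ x : ℝ, imagGaussKernel s C (2 * n) ((1 + s * Complex.I) * x) * (1 + s * Complex.I) := by
  obtain ⟨G, hG⟩ := (differentiable_imagGaussKernel s C (2 * n)).isExactOn_univ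
  replace hG : ∀ z, HasDerivAt G (imagGaussKernel s C (2 * n) z) z := fun z => hG z (Set.mem_univ z)
  have hGneg : ∀ z, HasDerivAt (fun z => -G (-z)) (imagGaussKernel s C (2 * n) z) z := by
    intro z
    have h := ((hG (-z)).comp z (hasDerivAt_neg z)).fun_neg
    have heven : imagGaussKernel s C (2 * n) (-z) = imagGaussKernel s C (2 * n) z := by
      simp [imagGaussKernel, pow_mul]
    rw [heven] at h
    simpa [Function.comp_def] using h
  have hint := integrable_imagGaussKernel_contour hs hC hε (2 * n)
  have hint' : Integrable fun x : ℝ =>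
      imagGaussKernel s C (2 * n) ((1 + s * Complex.I) * x) * (1 + s * Complex.I) := by
    simp_rw [imagGaussKernel_diagonal hs hC]
    exact ((integrable_pow_mul_exp_neg_sq_div hC (2 * n)).ofReal.const_mul _).mul_const _
  have hFTC : ∀ R : ℝ, ∫ x in -R..R,
      imagGaussKernel s C (2 * n) (gaussContourS s ε x) * gaussContourSDeriv s ε x =
        G (gaussContourS s ε R) - G (gaussContourS s ε (-R)) := fun R =>
    intervalIntegral.integral_eq_sub_of_hasDerivAt
      (fun x _ => (hG _).comp x (hasDerivAt_gaussContourS s ε x)) hint.intervalIntegrable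
  have hFTC' : ∀ R : ℝ, ∫ x in -R..R,
      imagGaussKernel s C (2 * n) ((1 + s * Complex.I) * x) * (1 + s * Complex.I) =
        G ((1 + s * Complex.I) * R) - G ((1 + s * Complex.I) * (-R : ℝ)) := fun R =>
    intervalIntegral.integral_eq_sub_of_hasDerivAt
      (fun x _ => (hG _).comp x (by
        simpa using (hasDerivAt_id x).ofReal_comp.const_mul (1 + s * Complex.I : ℂ)))
      hint'.intervalIntegrable
  have hlim := intervalIntegral_tendsto_integral hint tendsto_neg_atTop_atBot tendsto_id
  have hlim' := intervalIntegral_tendsto_integral hint' tendsto_neg_atTop_atBot tendsto_id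
  have hdiff := (tendsto_primitive_contour_sub_diagonal hs hC hε (2 * n) hG).add
    (tendsto_primitive_contour_sub_diagonal hs hC hε (2 * n) hGneg)
  have hodd : ∀ R, gaussContourS s ε (-R) = -gaussContourS s ε R := by
    intro R
    simp only [gaussContourS, Real.tanh_neg]
    push_cast
    ring
  refine (sub_eq_zero.1 (tendsto_nhds_unique ((hlim'.sub hlim).congr fun R => ?_)
    (by simpa using hdiff))).symm
  simp only [id, hFTC, hFTC', hodd]
  push_cast
  rw [mul_neg]
  ring

/-- the imaginary Gaussian integral of `z ^ (2n)` with covariance `± i C`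
equals `(± i C)^n (2n−1)!!`, for any regularized contour parameter `ε > 0`. -/
theorem imagGauss_moment_even (C : ℝ) (hC : 0 < C) (n : ℕ) (s : ℝ) (hs : s = 1 ∨ s = -1)
    (ε : ℝ) (hε : 0 < ε) :
    Integrable (fun x : ℝ =>
      Complex.exp (-(gaussContourS s ε x) ^ 2 / (s * 2 * Complex.I * C)) /
          (s * 2 * Real.pi * Complex.I * C) ^ ((1 : ℂ) / 2) *
        (gaussContourS s ε x) ^ (2 * n) * gaussContourSDeriv s ε x) ∧
    (∫ x : ℝ,
      Complex.exp (-(gaussContourS s ε x) ^ 2 / (s * 2 * Complex.I * C)) /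
          (s * 2 * Real.pi * Complex.I * C) ^ ((1 : ℂ) / 2) *
        (gaussContourS s ε x) ^ (2 * n) * gaussContourSDeriv s ε x)
      = (s * Complex.I * C) ^ n * ((2 * n - 1).doubleFactorial : ℕ) := by
  have hkernel : ∀ x : ℝ,
      Complex.exp (-(gaussContourS s ε x) ^ 2 / (s * 2 * Complex.I * C)) /
          (s * 2 * Real.pi * Complex.I * C) ^ ((1 : ℂ) / 2) *
        (gaussContourS s ε x) ^ (2 * n) * gaussContourSDeriv s ε x =
      ((s * 2 * Real.pi * Complex.I * C) ^ ((1 : ℂ) / 2))⁻¹ *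
        (imagGaussKernel s C (2 * n) (gaussContourS s ε x) * gaussContourSDeriv s ε x) := by
    intro x
    rw [imagGaussKernel]
    ring
  simp_rw [hkernel]
  refine ⟨(integrable_imagGaussKernel_contour hs hC hε (2 * n)).const_mul _, ?_⟩
  rw [integral_const_mul, integral_imagGaussKernel_contour hs hC hε, integral_mul_const]
  simp_rw [imagGaussKernel_diagonal hs hC]
  rw [integral_const_mul, integral_complex_ofReal, integral_pow_even_mul_exp_neg_sq_div hC,
    sign_two_pi_I_cpow_half hs hC]
  have hroot : ((√(π * C) : ℝ) : ℂ) ≠ 0 := by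
    exact_mod_cast (Real.sqrt_pos.2 (by positivity : 0 < π * C)).ne'
  have hone : (1 + s * Complex.I : ℂ) ≠ 0 := fun h => by simpa using congrArg Complex.re h
  push_cast
  rw [div_pow, mul_pow, mul_pow, mul_pow, mul_pow]
  field_simp
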